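/- (Existence of Mixed Strategy Nash Equilibrium) Every finite normal-form game has a mixed-strategy Nash equilibrium: for a finite nonempty type of players ι, finite nonempty strategy types S i, and payoffs u : ι → (Π i, S i) → ℝ, there exists a profile σ of mixed strategies (one probability distribution σ i on S i per player) such that for every player i and every probability distribution τ on S i, E_i(σ) ≥ E_i(Function.update σ i τ). In particular, every coarse-grained payoff matrix M'_k obtained by entropy-maximizing preprocessing admits at least one mixed strategy Nash equilibrium. -/

import Mathlib

/-- A mixed strategy on a finite strategy type: nonnegative weights summing to 1. -/
def IsMixedStrategy {A : Type*} [Fintype A] (σ : A → ℝ) : Prop :=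
  (∀ a : A, 0 ≤ σ a) ∧ ∑ a : A, σ a = 1

/-- Expected payoff of player `i` under the mixed-strategy profile `σ`. -/
def expectedPayoff {ι : Type*} [Fintype ι] [DecidableEq ι]
    {S : ι → Type*} [∀ i, Fintype (S i)]
    (u : ι → (∀ i, S i) → ℝ) (σ : ∀ i, S i → ℝ) (i : ι) : ℝ :=
  ∑ s : ∀ j, S j, (∏ j : ι, σ j (s j)) * u i s

/-- A mixed-strategy profile `σ` is a mixed Nash equilibrium if every component
is a mixed strategy and no player can improve their expected payoff by
unilaterally switching to another mixed strategy. -/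
def IsMixedNash {ι : Type*} [Fintype ι] [DecidableEq ι]
    {S : ι → Type*} [∀ i, Fintype (S i)]
    (u : ι → (∀ i, S i) → ℝ) (σ : ∀ i, S i → ℝ) : Prop :=
  (∀ i : ι, IsMixedStrategy (σ i)) ∧
  ∀ i : ι, ∀ τ : S i → ℝ, IsMixedStrategy τ →
    expectedPayoff u (Function.update σ i τ) i ≤ expectedPayoff u σ i

/-- A finite set `σ` is dominant for a family of rankings `R` if every element is ranked weakly
below all of `σ` by at least one of the rankings. -/
def IsDominant {I T L : Type*} [LinearOrder L] (R : I → T → L) (σ : Finset T) : Prop :=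
  ∀ y, ∃ i, ∀ x ∈ σ, R i y ≤ R i x

lemma IsDominant.mono {I T L : Type*} [LinearOrder L] {R : I → T → L} {σ τ : Finset T}
    (h : IsDominant R σ) (hτ : τ ⊆ σ) : IsDominant R τ := fun y =>
  (h y).imp fun _ hi x hx => hi x (hτ hx)

lemma injOn_erase_of_surjOn {I T : Type*} [Fintype I] [DecidableEq I] [DecidableEq T]
    {τ : Finset T} {m : I → T} (hcard : τ.card + 1 = Fintype.card I) {k : I}
    (hsurj : ∀ x ∈ τ, ∃ l, l ≠ k ∧ m l = x) {a b : I} (ha : a ≠ k) (hb : b ≠ k)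
    (hab : m a = m b) : a = b := by
  have hsub : τ ⊆ (Finset.univ.erase k).image m := by
    intro x hx
    obtain ⟨l, hl, rfl⟩ := hsurj x hx
    exact Finset.mem_image_of_mem _ (by simp [hl])
  have hk : (Finset.univ.erase k).card = τ.card := by
    rw [Finset.card_erase_of_mem (Finset.mem_univ k), Finset.card_univ]; omega
  have hinj : Set.InjOn m (Finset.univ.erase k : Finset I) :=
    Finset.card_image_iff.1 (le_antisymm Finset.card_image_le
      (hk.trans_le (Finset.card_le_card hsub)))
  exact hinj (by simp [ha]) (by simp [hb]) hab

open Classical in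
/-- **Pivoting.** A dominant set of corank one extends to exactly two dominant sets of full
size, provided that no ranking is redundant for it. -/
lemma IsDominant.even_card_extensions {I T L : Type*} [Fintype I] [Fintype T] [LinearOrder L]
    {R : I → T → L} (hR : ∀ i, Function.Injective (R i)) {τ : Finset T} (hne : τ.Nonempty)
    (hcard : τ.card + 1 = Fintype.card I) (hdom : IsDominant R τ)
    (hex : ∀ i, ∃ y, ∀ k, k ≠ i → ∃ x ∈ τ, R k x < R k y) :
    Even (Finset.univ.filter fun y => y ∉ τ ∧ IsDominant R (insert y τ)).card := by
  choose m hmτ hmin using fun i => Finset.exists_min_image τ (R i) hne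
  have heq : ∀ {i x}, x ∈ τ → (∀ z ∈ τ, R i x ≤ R i z) → m i = x := fun {i x} hx h =>
    hR i (le_antisymm (hmin i x hx) (h _ (hmτ i)))
  have hsurj : ∀ x ∈ τ, ∃ i, m i = x := fun x hx => (hdom x).imp fun i hi => heq hx hi
  obtain ⟨i, -, j, -, hij, hmij⟩ : ∃ i ∈ (Finset.univ : Finset I), ∃ j ∈ (Finset.univ : Finset I),
      i ≠ j ∧ m i = m j :=
    Finset.exists_ne_map_eq_of_card_lt_of_maps_to (t := τ) (by rw [Finset.card_univ]; omega)
      (fun i _ => hmτ i)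
  have hsurj' : ∀ k, k = i ∨ k = j → ∀ x ∈ τ, ∃ l, l ≠ k ∧ m l = x := by
    rintro k hk x hx
    obtain ⟨l, rfl⟩ := hsurj x hx
    by_cases hl : l = k
    · subst hl
      rcases hk with rfl | rfl
      · exact ⟨j, hij.symm, hmij.symm⟩
      · exact ⟨i, hij, hmij⟩
    · exact ⟨l, hl, rfl⟩
  let M : I → Finset T := fun k => Finset.univ.filter fun y => ∀ l, l ≠ k → R l (m l) < R l y
  have hM : ∀ {k y}, y ∈ M k ↔ ∀ l, l ≠ k → R l (m l) < R l y := by simp [M]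
  have hMne : ∀ k, (M k).Nonempty := fun k => by
    obtain ⟨y, hy⟩ := hex k
    refine ⟨y, hM.2 fun l hl => ?_⟩
    obtain ⟨x, hx, hxy⟩ := hy l hl
    exact (hmin l x hx).trans_lt hxy
  choose Y hYM hYmax using fun k => Finset.exists_max_image (M k) (R k) (hMne k)
  have hYle : ∀ k, ∀ x ∈ τ, R k (Y k) ≤ R k x := fun k => by
    obtain ⟨l, hl⟩ := hdom (Y k)
    by_cases hlk : l = k
    · exact hlk ▸ hl
    · exact absurd (hl _ (hmτ l)) (not_le.2 (hM.1 (hYM k) l hlk))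
  have hYgood : ∀ k, k = i ∨ k = j → Y k ∉ τ ∧ IsDominant R (insert (Y k) τ) := by
    intro k hk
    refine ⟨fun hy => ?_, fun z => ?_⟩
    · obtain ⟨l, hl, hl'⟩ := hsurj' k hk _ hy
      exact (hM.1 (hYM k) l hl).ne (by rw [hl'])
    · by_cases hz : z ∈ M k
      · refine ⟨k, fun x hx => ?_⟩
        rcases Finset.mem_insert.1 hx with rfl | hx
        · exact hYmax k z hz
        · exact (hYmax k z hz).trans (hYle k x hx)
      · rw [hM] at hz
        push Not at hz
        obtain ⟨l, hl, hzl⟩ := hz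
        refine ⟨l, fun x hx => ?_⟩
        rcases Finset.mem_insert.1 hx with rfl | hx
        · exact hzl.trans (hM.1 (hYM k) l hl).le
        · exact hzl.trans (hmin l x hx)
  have hYne : Y i ≠ Y j := fun h =>
    absurd (hYle i _ (hmτ i)) (not_le.2 (h ▸ hM.1 (hYM j) i hij))
  have hset : (Finset.univ.filter fun y => y ∉ τ ∧ IsDominant R (insert y τ)) = {Y i, Y j} := by
    ext y
    simp only [Finset.mem_filter, Finset.mem_univ, true_and, Finset.mem_insert,
      Finset.mem_singleton]
    constructor
    · rintro ⟨hy, hD⟩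
      obtain ⟨k, hk⟩ := hD y
      have hsk : ∀ x ∈ τ, ∃ l, l ≠ k ∧ m l = x ∧ R l x ≤ R l y := by
        intro x hx
        obtain ⟨l, hl⟩ := hD x
        refine ⟨l, ?_, heq hx fun z hz => hl z (Finset.mem_insert_of_mem hz),
          hl y (Finset.mem_insert_self _ _)⟩
        rintro rfl
        exact hy (hR l (le_antisymm (hk x (Finset.mem_insert_of_mem hx))
          (hl y (Finset.mem_insert_self _ _))) ▸ hx)
      have hinj : ∀ {a b}, a ≠ k → b ≠ k → m a = m b → a = b :=
        injOn_erase_of_surjOn hcard fun x hx => (hsk x hx).imp fun l h => ⟨h.1, h.2.1⟩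
      have hkij : k = i ∨ k = j := by
        by_contra! h
        exact hij (hinj h.1.symm h.2.symm hmij)
      have hyM : y ∈ M k := hM.2 fun l hl => by
        obtain ⟨l', hl', hml, hle⟩ := hsk (m l) (hmτ l)
        obtain rfl := hinj hl' hl hml
        exact hle.lt_of_ne fun h => hy (hR _ h ▸ hmτ l')
      have hYy : R k (Y k) ≤ R k y := by
        obtain ⟨l, hl⟩ := hD (Y k)
        by_cases hlk : l = k
        · exact hlk ▸ hl y (Finset.mem_insert_self _ _)
        · exact absurd (hl _ (Finset.mem_insert_of_mem (hmτ l)))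
            (not_le.2 (hM.1 (hYM k) l hlk))
      have hyY : y = Y k := hR k (le_antisymm (hYmax k y hyM) hYy)
      rcases hkij with rfl | rfl
      exacts [Or.inl hyY, Or.inr hyY]
    · rintro (rfl | rfl)
      · exact hYgood i (Or.inl rfl)
      · exact hYgood j (Or.inr rfl)
  rw [hset, Finset.card_pair hYne]
  exact even_two

open Classical in
/-- The facet of all but one of the slack elements `s i` has exactly one dominant extension. -/
lemma card_extensions_slack_facet {I T L : Type*} [Fintype I] [Fintype T] [LinearOrder L]
    {R : I → T → L} (hR : ∀ i, Function.Injective (R i)) {s : I → T}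
    (hs_min : ∀ i x, R i (s i) ≤ R i x)
    (hs_max : ∀ i k, k ≠ i → ∀ x, x ∉ Set.range s → R k x < R k (s i))
    (hT : ∃ x, x ∉ Set.range s) (i₀ : I) :
    (Finset.univ.filter fun y => y ∉ (Finset.univ.erase i₀).image s ∧
      IsDominant R (insert y ((Finset.univ.erase i₀).image s))).card = 1 := by
  obtain ⟨y₀, hy₀, hmax⟩ := Finset.exists_max_image
    (Finset.univ.filter fun x => x ∉ Set.range s) (R i₀) (by
      obtain ⟨x, hx⟩ := hT
      exact ⟨x, by simpa using hx⟩)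
  replace hy₀ : y₀ ∉ Set.range s := (Finset.mem_filter.1 hy₀).2
  replace hmax : ∀ x, x ∉ Set.range s → R i₀ x ≤ R i₀ y₀ := fun x hx =>
    hmax x (Finset.mem_filter.2 ⟨Finset.mem_univ _, hx⟩)
  have hmem : ∀ k, k ≠ i₀ → s k ∈ (Finset.univ.erase i₀).image s := fun k hk =>
    Finset.mem_image_of_mem _ (by simp [hk])
  rw [Finset.card_eq_one]
  refine ⟨y₀, ?_⟩
  ext y
  simp only [Finset.mem_filter, Finset.mem_univ, true_and, Finset.mem_singleton]
  constructor
  · rintro ⟨hy, hD⟩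
    obtain ⟨i, hi⟩ := hD y₀
    have hns : s i ∉ insert y ((Finset.univ.erase i₀).image s) := fun h =>
      hy₀ ⟨i, hR i (le_antisymm (hs_min i _) (hi _ h))⟩
    have hii : i = i₀ := by
      by_contra h
      exact hns (Finset.mem_insert_of_mem (hmem i h))
    subst hii
    have hyr : y ∉ Set.range s := by
      rintro ⟨k, rfl⟩
      by_cases hk : k = i
      · exact hns (hk ▸ Finset.mem_insert_self _ _)
      · exact hy (hmem k hk)
    exact hR i (le_antisymm (hmax y hyr) (hi y (Finset.mem_insert_self _ _)))
  · rintro rfl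
    refine ⟨fun h => ?_, fun z => ?_⟩
    · obtain ⟨k, -, hk⟩ := Finset.mem_image.1 h
      exact hy₀ ⟨k, hk⟩
    · by_cases hz : z ∈ Set.range s
      · obtain ⟨k, rfl⟩ := hz
        exact ⟨k, fun x _ => hs_min k x⟩
      · refine ⟨i₀, fun x hx => ?_⟩
        rcases Finset.mem_insert.1 hx with rfl | hx
        · exact hmax z hz
        · obtain ⟨k, hk, rfl⟩ := Finset.mem_image.1 hx
          exact (hs_max k i₀ (Finset.ne_of_mem_erase hk).symm z hz).le

/-- A set of full size that misses a colour has an even number of facets carrying precisely the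
colours other than `i₀`. -/
lemma even_card_facets_of_not_rainbow {I T : Type*} [Fintype I] [DecidableEq I] [DecidableEq T]
    (c : T → I) (i₀ : I) {σ : Finset T} (hcard : σ.card = Fintype.card I)
    (hσ : σ.image c ≠ Finset.univ) :
    Even (σ.filter fun x => (σ.erase x).image c = Finset.univ.erase i₀).card := by
  rcases (σ.filter fun x => (σ.erase x).image c = Finset.univ.erase i₀).eq_empty_or_nonempty with
    h | ⟨x, hx⟩
  · simp [h]
  have hinj : ∀ z ∈ σ, (σ.erase z).image c = Finset.univ.erase i₀ →
      Set.InjOn c (σ.erase z : Finset T) := fun z hz h => by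
    rw [← Finset.card_image_iff, h, Finset.card_erase_of_mem hz,
      Finset.card_erase_of_mem (Finset.mem_univ _), hcard, Finset.card_univ]
  obtain ⟨hxσ, hxc⟩ := Finset.mem_filter.1 hx
  have hcx : c x ≠ i₀ := by
    intro h
    apply hσ
    rw [← Finset.insert_erase hxσ, Finset.image_insert, hxc, h,
      Finset.insert_erase (Finset.mem_univ _)]
  obtain ⟨x', hx', hxx'⟩ : ∃ x' ∈ σ.erase x, c x' = c x := by
    rw [← Finset.mem_image, hxc]
    simp [hcx]
  have hne : x' ≠ x := Finset.ne_of_mem_erase hx'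
  have hx'σ : x' ∈ σ := Finset.mem_of_mem_erase hx'
  have hx'c : (σ.erase x').image c = Finset.univ.erase i₀ := by
    rw [← hxc]
    ext i
    simp only [Finset.mem_image, Finset.mem_erase]
    constructor
    · rintro ⟨z, ⟨hz, hzσ⟩, rfl⟩
      by_cases h : z = x
      · exact ⟨x', ⟨hne, hx'σ⟩, h ▸ hxx'⟩
      · exact ⟨z, ⟨h, hzσ⟩, rfl⟩
    · rintro ⟨z, ⟨hz, hzσ⟩, rfl⟩
      by_cases h : z = x'
      · exact ⟨x, ⟨hne.symm, hxσ⟩, h ▸ hxx'.symm⟩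
      · exact ⟨z, ⟨h, hzσ⟩, rfl⟩
  have hset : (σ.filter fun x => (σ.erase x).image c = Finset.univ.erase i₀) = {x, x'} := by
    ext z
    simp only [Finset.mem_filter, Finset.mem_insert, Finset.mem_singleton]
    constructor
    · rintro ⟨hz, hzc⟩
      by_contra! h
      exact hne (hinj z hz hzc (by simp [h.2.symm, hx'σ]) (by simp [h.1.symm, hxσ]) hxx')
    · rintro (rfl | rfl)
      exacts [⟨hxσ, hxc⟩, ⟨hx'σ, hx'c⟩]
  rw [hset, Finset.card_pair hne.symm]
  exact even_two

open Classical in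
/-- **Scarf's lemma**: for every colouring that gives each slack element its own index, there is
a dominant set carrying each colour exactly once. -/
lemma exists_rainbow_dominant {I T L : Type*} [Fintype I] [Nonempty I] [Fintype T]
    [LinearOrder L] {R : I → T → L} (hR : ∀ i, Function.Injective (R i)) {s : I → T}
    (hs_min : ∀ i x, R i (s i) ≤ R i x)
    (hs_max : ∀ i k, k ≠ i → ∀ x, x ∉ Set.range s → R k x < R k (s i))
    (hT : ∃ x, x ∉ Set.range s) (c : T → I) (hc : ∀ i, c (s i) = i) :
    ∃ σ : Finset T, IsDominant R σ ∧ σ.card = Fintype.card I ∧ σ.image c = Finset.univ := by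
  by_contra! hno
  obtain ⟨i₀⟩ := ‹Nonempty I›
  let facets : Finset (Finset T) := Finset.univ.filter fun τ =>
    τ.card + 1 = Fintype.card I ∧ τ.image c = Finset.univ.erase i₀
  let rooms : Finset (Finset T) := Finset.univ.filter fun σ =>
    σ.card = Fintype.card I ∧ IsDominant R σ
  let ext : Finset T → Finset T := fun τ =>
    Finset.univ.filter fun y => y ∉ τ ∧ IsDominant R (insert y τ)
  let drop : Finset T → Finset T := fun σ =>
    σ.filter fun x => (σ.erase x).image c = Finset.univ.erase i₀
  have hcount : ∑ τ ∈ facets, (ext τ).card = ∑ σ ∈ rooms, (drop σ).card := by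
    rw [← Finset.card_sigma, ← Finset.card_sigma]
    refine Finset.card_bij' (fun p _ => ⟨insert p.2 p.1, p.2⟩) (fun p _ => ⟨p.1.erase p.2, p.2⟩)
      ?_ ?_ ?_ ?_
    · rintro ⟨τ, y⟩ h
      simp only [facets, ext, rooms, drop, Finset.mem_sigma, Finset.mem_filter, Finset.mem_univ,
        true_and] at h ⊢
      obtain ⟨⟨h1, h2⟩, h3, h4⟩ := h
      exact ⟨⟨by rw [Finset.card_insert_of_notMem h3, h1], h4⟩, Finset.mem_insert_self _ _,
        by rw [Finset.erase_insert h3, h2]⟩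
    · rintro ⟨σ, x⟩ h
      simp only [facets, ext, rooms, drop, Finset.mem_sigma, Finset.mem_filter, Finset.mem_univ,
        true_and] at h ⊢
      obtain ⟨⟨h1, h2⟩, h3, h4⟩ := h
      exact ⟨⟨by rw [Finset.card_erase_add_one h3, h1], h4⟩, Finset.notMem_erase _ _,
        by rwa [Finset.insert_erase h3]⟩
    · rintro ⟨τ, y⟩ h
      simp only [facets, ext, Finset.mem_sigma, Finset.mem_filter, Finset.mem_univ,
        true_and] at h
      simp [Finset.erase_insert h.2.1]
    · rintro ⟨σ, x⟩ h
      simp only [rooms, drop, Finset.mem_sigma, Finset.mem_filter] at h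
      simp [Finset.insert_erase h.2.1]
  have heven : Even (∑ σ ∈ rooms, (drop σ).card) := by
    refine Finset.even_sum _ fun σ hσ => ?_
    obtain ⟨h1, h2⟩ := (Finset.mem_filter.1 hσ).2
    exact even_card_facets_of_not_rainbow c i₀ h1 (hno σ h2 h1)
  have hs_inj : Function.Injective s := fun a b h => by rw [← hc a, h, hc]
  let τ₀ : Finset T := (Finset.univ.erase i₀).image s
  have hτ₀ : τ₀ ∈ facets := by
    refine Finset.mem_filter.2 ⟨Finset.mem_univ _, ?_, ?_⟩
    · rw [Finset.card_image_of_injective _ hs_inj,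
        Finset.card_erase_add_one (Finset.mem_univ _), Finset.card_univ]
    · rw [Finset.image_image, show c ∘ s = id from funext hc, Finset.image_id]
  have hrest : Even (∑ τ ∈ facets.erase τ₀, (ext τ).card) := by
    refine Finset.even_sum _ fun τ hτ => ?_
    obtain ⟨hne, hτ⟩ := Finset.mem_erase.1 hτ
    obtain ⟨h1, h2⟩ := (Finset.mem_filter.1 hτ).2
    by_cases hdom : IsDominant R τ
    · obtain ⟨x, hx, hxs⟩ : ∃ x ∈ τ, x ∉ Set.range s := by
        by_contra! h
        apply hne
        ext x
        simp only [τ₀, Finset.mem_image]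
        constructor
        · intro hx
          obtain ⟨k, rfl⟩ := h x hx
          exact ⟨k, h2 ▸ Finset.mem_image.2 ⟨_, hx, hc k⟩, rfl⟩
        · rintro ⟨k, hk, rfl⟩
          rw [← h2] at hk
          obtain ⟨z, hz, rfl⟩ := Finset.mem_image.1 hk
          obtain ⟨l, rfl⟩ := h z hz
          rwa [hc]
      exact hdom.even_card_extensions hR ⟨x, hx⟩ h1
        fun i => ⟨s i, fun k hk => ⟨x, hx, hs_max i k hk x hxs⟩⟩
    · have : ext τ = ∅ := Finset.filter_eq_empty_iff.2 fun y _ h =>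
        hdom (h.2.mono (Finset.subset_insert _ _))
      simp [this]
  have hone : (ext τ₀).card = 1 := card_extensions_slack_facet hR hs_min hs_max hT i₀
  rw [← hcount, ← Finset.add_sum_erase _ _ hτ₀, hone] at heven
  exact (Nat.not_even_iff_odd.2 (odd_one.add_even hrest)) heven

open Classical in
/-- A self-map of the simplex is almost coordinatewise increasing somewhere, at the scale of the
grid of mesh `1 / N`. -/
lemma exists_approx_le_map_stdSimplex {I : Type*} [Fintype I] [Nonempty I]
    {f : (I → ℝ) → I → ℝ} (hf : Set.MapsTo f (stdSimplex ℝ I) (stdSimplex ℝ I))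
    {N : ℕ} (hN : 0 < N) :
    ∃ p ∈ stdSimplex ℝ I, ∀ i, ∃ x ∈ stdSimplex ℝ I,
      (∀ k, |x k - p k| ≤ (Fintype.card I : ℝ) / N) ∧
        x i ≤ f x i + (Fintype.card I : ℝ) / N := by
  have hN' : (0 : ℝ) < N := Nat.cast_pos.2 hN
  let G := {a : I → ℕ // ∑ i, a i = N}
  have hG : ∀ a : I → ℕ, a ∈ Finset.piAntidiag Finset.univ N ↔ ∑ i, a i = N := by simp
  have : Fintype G := Fintype.subtype _ hG
  let pt : G → I → ℝ := fun a i => (a.1 i : ℝ) / N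
  have hpt : ∀ a, pt a ∈ stdSimplex ℝ I := fun a => by
    refine ⟨fun i => by positivity, ?_⟩
    rw [← Finset.sum_div, ← Nat.cast_sum, a.2, div_self hN'.ne']
  have hcol : ∀ a : G, ∃ i, pt a i ≤ f (pt a) i := fun a => by
    by_contra! h
    have := Finset.sum_lt_sum_of_nonempty Finset.univ_nonempty fun i _ => h i
    rw [(hpt a).2, (hf (hpt a)).2] at this
    exact this.false
  choose col hcol using hcol
  let g : I → G ⊕ I → ℤ := fun i => Sum.elim (fun a => a.1 i) fun k => if k = i then -1 else N + 1
  let R : I → G ⊕ I → ℤ ×ₗ Fin (Fintype.card (G ⊕ I)) := fun i x =>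
    toLex (g i x, Fintype.equivFin _ x)
  have hR : ∀ i, Function.Injective (R i) := fun i x y h =>
    (Fintype.equivFin (G ⊕ I)).injective (congrArg (fun z => (ofLex z).2) h)
  have hRlt : ∀ {i x y}, g i x < g i y → R i x < R i y := fun h =>
    Prod.Lex.toLex_lt_toLex.2 (Or.inl h)
  have hRle : ∀ {i x y}, R i x ≤ R i y → g i x ≤ g i y := fun h =>
    not_lt.1 fun h' => (hRlt h').not_ge h
  have hgle : ∀ i (a : G), a.1 i ≤ N := fun i a =>
    (Finset.single_le_sum (fun _ _ => Nat.zero_le _) (Finset.mem_univ i)).trans a.2.le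
  have hginl : ∀ i (a : G), g i (Sum.inl a) = a.1 i := fun _ _ => rfl
  have hgself : ∀ i, g i (Sum.inr i) = -1 := fun i => if_pos rfl
  have hgne : ∀ i k, k ≠ i → g i (Sum.inr k) = N + 1 := fun i k h => if_neg h
  obtain ⟨i₁⟩ := ‹Nonempty I›
  let a₀ : G := ⟨Pi.single i₁ N, by simp⟩
  obtain ⟨σ, hdom, hcard, hrain⟩ := exists_rainbow_dominant hR (s := Sum.inr)
    (fun i x => by
      by_cases hx : x = Sum.inr i
      · rw [hx]
      · refine (hRlt ?_).le
        rw [hgself]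
        rcases x with a | k
        · rw [hginl]; omega
        · rw [hgne i k fun h => hx (h ▸ rfl)]; omega)
    (fun i k hk x hx => by
      refine hRlt ?_
      rcases x with a | l
      · rw [hginl, hgne k i hk.symm]
        have := hgle k a
        omega
      · exact absurd ⟨l, rfl⟩ hx)
    ⟨Sum.inl a₀, by simp⟩ (Sum.elim col id) (fun i => rfl)
  have hkey : ∀ y : G, ∃ i, Sum.inr i ∉ σ ∧ ∀ a : G, Sum.inl a ∈ σ → y.1 i ≤ a.1 i := fun y => by
    obtain ⟨i, hi⟩ := hdom (Sum.inl y)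
    refine ⟨i, fun h => ?_, fun a ha => ?_⟩
    · have := hRle (hi _ h)
      rw [hginl, hgself] at this
      omega
    · have := hRle (hi _ ha)
      rw [hginl, hginl] at this
      exact_mod_cast this
  obtain ⟨i₂, hi₂, -⟩ := hkey a₀
  have hrain' : ∀ i, Sum.inr i ∉ σ → ∃ a : G, Sum.inl a ∈ σ ∧ col a = i := fun i hi => by
    obtain ⟨x, hx, rfl⟩ := Finset.mem_image.1 (hrain ▸ Finset.mem_univ i)
    rcases x with a | k
    · exact ⟨a, hx, rfl⟩
    · exact absurd hx hi
  obtain ⟨p, hp, -⟩ := hrain' i₂ hi₂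
  choose m hmσ hmin using fun i => Finset.exists_min_image
    (Finset.univ.filter fun a : G => Sum.inl a ∈ σ) (fun a => a.1 i)
    ⟨p, by simpa using hp⟩
  simp only [Finset.mem_filter, Finset.mem_univ, true_and] at hmσ hmin
  let b : I → ℕ := fun i => if Sum.inr i ∈ σ then 0 else (m i).1 i
  have hb : ∀ i (a : G), Sum.inl a ∈ σ → b i ≤ a.1 i := fun i a ha => by
    by_cases h : Sum.inr i ∈ σ
    · simp [b, h]
    · simpa [b, h] using hmin i a ha
  let y : I → ℕ := fun i => if Sum.inr i ∈ σ then 0 else b i + 1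
  have hysum : N < ∑ i, y i := by
    by_contra! h
    obtain ⟨i, hi, hle⟩ := hkey ⟨fun i => y i + Pi.single (M := fun _ => ℕ) i₂ (N - ∑ i, y i) i, by
      rw [Finset.sum_add_distrib, Finset.sum_pi_single']
      simp
      omega⟩
    have := hle (m i) (hmσ i)
    simp only [y, b, hi, if_false] at this
    omega
  have hbsum : N < ∑ i, b i + Fintype.card I := by
    refine hysum.trans_le ?_
    rw [← Finset.card_univ, Finset.card_eq_sum_ones, ← Finset.sum_add_distrib]
    refine Finset.sum_le_sum fun i _ => ?_
    simp only [y]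
    split_ifs <;> omega
  have hlt : ∀ i (a : G), Sum.inl a ∈ σ → a.1 i < b i + Fintype.card I := fun i a ha => by
    have h1 := Finset.add_sum_erase Finset.univ b (Finset.mem_univ i)
    have h2 := Finset.add_sum_erase Finset.univ a.1 (Finset.mem_univ i)
    have h3 : ∑ k ∈ Finset.univ.erase i, b k ≤ ∑ k ∈ Finset.univ.erase i, a.1 k :=
      Finset.sum_le_sum fun k _ => hb k a ha
    have h4 := a.2
    omega
  refine ⟨pt p, hpt p, fun i => ?_⟩
  have hclose : ∀ a : G, Sum.inl a ∈ σ → ∀ k,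
      |pt a k - pt p k| ≤ (Fintype.card I : ℝ) / N := fun a ha k => by
    have h1 : (a.1 k : ℝ) ≤ p.1 k + Fintype.card I := by
      have := hlt k a ha
      have := hb k p hp
      exact_mod_cast (by omega : a.1 k ≤ p.1 k + Fintype.card I)
    have h2 : (p.1 k : ℝ) ≤ a.1 k + Fintype.card I := by
      have := hlt k p hp
      have := hb k a ha
      exact_mod_cast (by omega : p.1 k ≤ a.1 k + Fintype.card I)
    simp only [pt]
    rw [← sub_div, abs_div, abs_of_pos hN']
    gcongr
    rw [abs_le]
    constructor <;> linarith
  by_cases hi : Sum.inr i ∈ σ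
  · refine ⟨pt p, hpt p, hclose p hp, ?_⟩
    have h1 : p.1 i ≤ Fintype.card I := by
      have := hlt i p hp
      simp only [b, hi, if_true] at this
      omega
    have h2 : pt p i ≤ (Fintype.card I : ℝ) / N := by
      simp only [pt]
      gcongr
    linarith [(hf (hpt p)).1 i]
  · obtain ⟨a, ha, rfl⟩ := hrain' i hi
    refine ⟨pt a, hpt a, hclose a ha, (hcol a).trans ?_⟩
    linarith [show 0 ≤ (Fintype.card I : ℝ) / N by positivity]

open Filter Topology in
/-- **Brouwer's fixed point theorem** on the standard simplex. -/
theorem exists_fixedPoint_stdSimplex {I : Type*} [Fintype I] [Nonempty I]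
    {f : (I → ℝ) → I → ℝ} (hf : Set.MapsTo f (stdSimplex ℝ I) (stdSimplex ℝ I))
    (hcont : ContinuousOn f (stdSimplex ℝ I)) : ∃ p ∈ stdSimplex ℝ I, f p = p := by
  choose p hp x hx hclose hle using fun n : ℕ =>
    exists_approx_le_map_stdSimplex hf (N := n + 1) n.succ_pos
  obtain ⟨q, hq, φ, hφ, hlim⟩ := (isCompact_stdSimplex ℝ I).tendsto_subseq hp
  have hε : Tendsto (fun n => (Fintype.card I : ℝ) / ((φ n + 1 : ℕ) : ℝ)) atTop (𝓝 0) :=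
    (tendsto_const_div_atTop_nhds_zero_nat _).comp
      ((tendsto_add_atTop_nat 1).comp hφ.tendsto_atTop)
  have hxlim : ∀ i, Tendsto (fun n => x (φ n) i) atTop (𝓝 q) := fun i => by
    rw [tendsto_pi_nhds] at hlim ⊢
    intro k
    have h0 : Tendsto (fun n => x (φ n) i k - p (φ n) k) atTop (𝓝 0) :=
      squeeze_zero_norm (fun n => hclose (φ n) i k) hε
    simpa using h0.add (hlim k)
  have hqle : ∀ i, q i ≤ f q i := fun i => by
    have h1 : Tendsto (fun n => x (φ n) i i) atTop (𝓝 (q i)) := (tendsto_pi_nhds.1 (hxlim i)) i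
    have h2 : Tendsto (fun n => f (x (φ n) i)) atTop (𝓝 (f q)) :=
      (hcont q hq).tendsto.comp
        (tendsto_nhdsWithin_iff.2 ⟨hxlim i, Eventually.of_forall fun n => hx (φ n) i⟩)
    have h3 := ((tendsto_pi_nhds.1 h2) i).add hε
    rw [add_zero] at h3
    exact le_of_tendsto_of_tendsto' h1 h3 fun n => hle (φ n) i
  refine ⟨q, hq, funext fun i => ?_⟩
  have := (Finset.sum_eq_sum_iff_of_le fun i _ => hqle i).1 (hq.2.trans (hf hq).2.symm)
  exact (this i (Finset.mem_univ i)).symm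

lemma sum_prod_eval {ι : Type*} [Fintype ι] [DecidableEq ι] {S : ι → Type*} [∀ i, Fintype (S i)]
    (w : ∀ i, S i → ℝ) : ∑ s : ∀ j, S j, ∏ j, w j (s j) = ∏ j, ∑ a, w j a := by
  rw [Finset.prod_univ_sum, Fintype.piFinset_univ]

lemma prod_update_eval {ι : Type*} [Fintype ι] [DecidableEq ι] {S : ι → Type*}
    (σ : ∀ i, S i → ℝ) (i : ι) (τ : S i → ℝ) (s : ∀ j, S j) :
    ∏ j, Function.update σ i τ j (s j) = τ (s i) * ∏ j ∈ Finset.univ.erase i, σ j (s j) := by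
  rw [← Finset.mul_prod_erase _ _ (Finset.mem_univ i), Function.update_self]
  congr 1
  refine Finset.prod_congr rfl fun j hj => ?_
  rw [Function.update_of_ne (Finset.ne_of_mem_erase hj)]

open Classical in
/-- The marginals of a product distribution are its factors. -/
lemma marginal_prod {ι : Type*} [Fintype ι] [DecidableEq ι] {S : ι → Type*} [∀ i, Fintype (S i)]
    {σ : ∀ i, S i → ℝ} (hσ : ∀ i, IsMixedStrategy (σ i)) (i : ι) (a : S i) :
    (∑ s : ∀ j, S j, if s i = a then ∏ j, σ j (s j) else 0) = σ i a := by
  have h : ∀ s : ∀ j, S j, (if s i = a then ∏ j, σ j (s j) else 0) =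
      ∏ j, Function.update σ i (fun b => if b = a then σ i b else 0) j (s j) := fun s => by
    rw [prod_update_eval, ite_mul, zero_mul, Finset.mul_prod_erase _ (fun j => σ j (s j))
      (Finset.mem_univ i)]
  simp_rw [h]
  rw [sum_prod_eval, ← Finset.mul_prod_erase _ _ (Finset.mem_univ i), Finset.prod_eq_one]
  · simp
  · intro j hj
    rw [Function.update_of_ne (Finset.ne_of_mem_erase hj), (hσ j).2]

open Classical in
/-- **Brouwer's fixed point theorem** for a product of simplices. -/
theorem exists_fixedPoint_mixed {ι : Type*} [Fintype ι] {S : ι → Type*}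
    [∀ i, Fintype (S i)] [∀ i, Nonempty (S i)] {f : (∀ i, S i → ℝ) → ∀ i, S i → ℝ}
    (hf : ∀ σ, (∀ i, IsMixedStrategy (σ i)) → ∀ i, IsMixedStrategy (f σ i))
    (hcont : Continuous f) : ∃ σ, (∀ i, IsMixedStrategy (σ i)) ∧ f σ = σ := by
  let marg : ((∀ i, S i) → ℝ) → ∀ i, S i → ℝ := fun μ i a => ∑ s, if s i = a then μ s else 0
  let prd : (∀ i, S i → ℝ) → (∀ i, S i) → ℝ := fun σ s => ∏ j, σ j (s j)
  have hmarg : ∀ μ ∈ stdSimplex ℝ (∀ i, S i), ∀ i, IsMixedStrategy (marg μ i) := by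
    refine fun μ hμ i => ⟨fun a => Finset.sum_nonneg fun s _ => ?_, ?_⟩
    · split_ifs
      exacts [hμ.1 s, le_rfl]
    · simp only [marg]
      rw [Finset.sum_comm]
      simpa using hμ.2
  have hprd : ∀ σ, (∀ i, IsMixedStrategy (σ i)) → prd σ ∈ stdSimplex ℝ (∀ i, S i) := by
    refine fun σ hσ => ⟨fun s => Finset.prod_nonneg fun j _ => (hσ j).1 _, ?_⟩
    simp only [prd]
    rw [sum_prod_eval]
    exact Finset.prod_eq_one fun j _ => (hσ j).2
  have hmcont : Continuous marg := continuous_pi fun i => continuous_pi fun a =>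
    continuous_finsetSum _ fun s _ => by split_ifs <;> fun_prop
  have hpcont : Continuous prd := by fun_prop
  obtain ⟨μ, hμ, hfix⟩ := exists_fixedPoint_stdSimplex (f := fun μ => prd (f (marg μ)))
    (fun μ hμ => hprd _ (hf _ (hmarg μ hμ))) (hpcont.comp (hcont.comp hmcont)).continuousOn
  refine ⟨marg μ, hmarg μ hμ, ?_⟩
  conv_rhs => rw [← hfix]
  ext i a
  exact (marginal_prod (hf _ (hmarg μ hμ)) i a).symm

open Classical in
lemma expectedPayoff_update {ι : Type*} [Fintype ι] [DecidableEq ι] {S : ι → Type*}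
    [∀ i, Fintype (S i)] (u : ι → (∀ i, S i) → ℝ) (σ : ∀ i, S i → ℝ) (i : ι) (τ : S i → ℝ) :
    expectedPayoff u (Function.update σ i τ) i =
      ∑ a, τ a * expectedPayoff u (Function.update σ i (Pi.single a 1)) i := by
  simp only [expectedPayoff, prod_update_eval, Finset.mul_sum]
  rw [Finset.sum_comm]
  refine Finset.sum_congr rfl fun s _ => ?_
  rw [Finset.sum_eq_single (s i)]
  · simp [mul_assoc]
  · intro a _ ha
    simp [Pi.single_eq_of_ne' ha]
  · simp

lemma continuous_expectedPayoff {ι : Type*} [Fintype ι] [DecidableEq ι] {S : ι → Type*}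
    [∀ i, Fintype (S i)] (u : ι → (∀ i, S i) → ℝ) (i : ι) :
    Continuous fun σ : ∀ i, S i → ℝ => expectedPayoff u σ i := by
  unfold expectedPayoff
  fun_prop

/-- Existence of Mixed Strategy Nash Equilibrium: every finite
normal-form game (in particular every coarse-grained payoff matrix obtained by
entropy-maximizing preprocessing) has a mixed-strategy Nash equilibrium. -/
theorem exists_mixedNash {ι : Type*} [Fintype ι] [Nonempty ι] [DecidableEq ι]
    {S : ι → Type*} [∀ i, Fintype (S i)] [∀ i, Nonempty (S i)]
    (u : ι → (∀ i, S i) → ℝ) :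
    ∃ σ : ∀ i, S i → ℝ, IsMixedNash u σ := by
  classical
  let V : (∀ i, S i → ℝ) → ∀ i, S i → ℝ := fun σ i a =>
    expectedPayoff u (Function.update σ i (Pi.single a 1)) i
  let gain : (∀ i, S i → ℝ) → ∀ i, S i → ℝ := fun σ i a => max 0 (V σ i a - expectedPayoff u σ i)
  have hgain : ∀ σ i a, 0 ≤ gain σ i a := fun σ i a => le_max_left _ _
  have hgcont : ∀ i a, Continuous fun σ => gain σ i a := fun i a =>
    continuous_const.max (((continuous_expectedPayoff u i).comp
      (continuous_id.update i continuous_const)).sub (continuous_expectedPayoff u i))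
  have hden : ∀ σ i, 0 < 1 + ∑ b, gain σ i b := fun σ i =>
    add_pos_of_pos_of_nonneg one_pos (Finset.sum_nonneg fun b _ => hgain σ i b)
  obtain ⟨σ, hσ, hfix⟩ := exists_fixedPoint_mixed
    (f := fun σ i a => (σ i a + gain σ i a) / (1 + ∑ b, gain σ i b))
    (fun σ hσ i => ⟨fun a => div_nonneg (add_nonneg ((hσ i).1 a) (hgain σ i a)) (hden σ i).le, by
      rw [← Finset.sum_div, Finset.sum_add_distrib, (hσ i).2, div_self (hden σ i).ne']⟩)
    (continuous_pi fun i => continuous_pi fun a =>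
      (((continuous_apply a).comp (continuous_apply i)).add (hgcont i a)).div
        (continuous_const.add (continuous_finsetSum _ fun b _ => hgcont i b))
        fun σ => (hden σ i).ne')
  refine ⟨σ, hσ, fun i τ hτ => ?_⟩
  have hprop : ∀ a, gain σ i a = σ i a * ∑ b, gain σ i b := fun a => by
    have := congrFun (congrFun hfix i) a
    rw [div_eq_iff (hden σ i).ne'] at this
    linarith
  have havg : ∑ a, σ i a * (V σ i a - expectedPayoff u σ i) = 0 := by
    have := expectedPayoff_update u σ i (σ i)
    rw [Function.update_eq_self] at this
    simp only [mul_sub, Finset.sum_sub_distrib]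
    rw [← Finset.sum_mul, (hσ i).2, one_mul, ← this, sub_self]
  have hsq : ∑ a, gain σ i a ^ 2 = 0 := by
    rw [← mul_zero (∑ b, gain σ i b), ← havg, Finset.mul_sum]
    refine Finset.sum_congr rfl fun a _ => ?_
    rw [← mul_assoc, mul_comm _ (σ i a), ← hprop a, sq]
    rcases max_choice 0 (V σ i a - expectedPayoff u σ i) with h | h
    · rw [show gain σ i a = 0 from h, zero_mul, zero_mul]
    · rw [← show gain σ i a = V σ i a - expectedPayoff u σ i from h]
  have hle : ∀ a, V σ i a ≤ expectedPayoff u σ i := fun a => by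
    have h0 : gain σ i a = 0 := pow_eq_zero_iff two_ne_zero |>.1
      ((Finset.sum_eq_zero_iff_of_nonneg fun a _ => sq_nonneg _).1 hsq a (Finset.mem_univ a))
    exact sub_nonpos.1 ((le_max_right _ _).trans h0.le)
  rw [expectedPayoff_update]
  calc ∑ a, τ a * V σ i a ≤ ∑ a, τ a * expectedPayoff u σ i :=
        Finset.sum_le_sum fun a _ => mul_le_mul_of_nonneg_left (hle a) (hτ.1 a)
    _ = expectedPayoff u σ i := by rw [← Finset.sum_mul, hτ.2, one_mul]
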